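/- arXiv:2202.08380 — 3 statements merged into one kernel-verified Lean document; each statement's English description precedes it below -/
import Mathlib

section
/- (Spin alignment conjecture, case n = 1, arbitrary dimension.) Let Q be a density matrix on ℂ^d, let λ_max be its largest eigenvalue, let γ ∈ ℂ^d be a unit vector with Qγ = λ_max·γ, and let x ∈ [0,1]. Then for every density matrix ω on ℂ^d, S(x·γγ† + (1−x)·Q) ≤ S(x·ω + (1−x)·Q). -/
open Matrix ComplexOrder

/-- Von Neumann entropy (base-2) of a matrix: −∑ λᵢ log₂ λᵢ over its eigenvalues
(0 if the matrix is not Hermitian). -/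
noncomputable def vnEntropy {n : ℕ} (ρ : Matrix (Fin n) (Fin n) ℂ) : ℝ :=
  if h : ρ.IsHermitian then -∑ i, (h.eigenvalues i) * Real.logb 2 (h.eigenvalues i) else 0


lemma sa_charpoly_rank_one {d : ℕ} (M : Matrix (Fin d) (Fin d) ℂ) (γ : Fin d → ℂ) (c x : ℂ)
    (hu : star γ ⬝ᵥ γ = 1) (hM : M *ᵥ γ = c • γ) :
    (x • Matrix.vecMulVec γ (star γ) + M).charpoly * (Polynomial.X - Polynomial.C c) =
      M.charpoly * (Polynomial.X - Polynomial.C (c + x)) := by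
  apply Polynomial.eq_of_infinite_eval_eq
  refine Set.Infinite.mono (s := {c}ᶜ) ?_ (Set.finite_singleton c).infinite_compl
  intro t ht
  have ht' : t - c ≠ 0 := sub_ne_zero.mpr ht
  simp only [Set.mem_ofPred_eq, Polynomial.eval_mul, Matrix.eval_charpoly, Polynomial.eval_sub,
    Polynomial.eval_X, Polynomial.eval_C]
  have key : Matrix.scalar (Fin d) t - (x • Matrix.vecMulVec γ (star γ) + M) =
      (Matrix.scalar (Fin d) t - M) * (1 + Matrix.replicateCol Unit (-(x / (t - c)) • γ) *
        Matrix.replicateRow Unit (star γ)) := by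
    have h1 : (Matrix.scalar (Fin d) t - M) * (Matrix.replicateCol Unit (-(x / (t - c)) • γ) *
        Matrix.replicateRow Unit (star γ)) = - (x • Matrix.vecMulVec γ (star γ)) := by
      rw [← Matrix.vecMulVec_eq, Matrix.mul_vecMulVec, Matrix.mulVec_smul, Matrix.sub_mulVec, hM]
      have : (Matrix.scalar (Fin d) t) *ᵥ γ = t • γ := by
        ext i; simp [Matrix.scalar_apply, Matrix.mulVec_diagonal]
      rw [this, ← sub_smul, smul_smul, neg_mul, div_mul_cancel₀ _ ht', Matrix.smul_vecMulVec, neg_smul]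
    rw [mul_add, h1, mul_one]; abel
  rw [key, Matrix.det_mul, Matrix.det_one_add_replicateCol_mul_replicateRow]
  rw [dotProduct_smul, hu]
  simp only [smul_eq_mul]
  field_simp
  ring

lemma sa_charpoly_smul {d : ℕ} (Q : Matrix (Fin d) (Fin d) ℂ) (h : Q.IsHermitian) (s : ℝ) :
    ((s : ℂ) • Q).charpoly =
      ∏ i, (Polynomial.X - Polynomial.C (((s * h.eigenvalues i : ℝ)) : ℂ)) := by
  conv_lhs => rw [h.spectral_theorem, ← map_smul, Unitary.conjStarAlgAut_apply,
    Matrix.charpoly_mul_comm, ← mul_assoc]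
  rw [← Matrix.diagonal_smul]
  simp only [Unitary.coe_star_mul_self, one_mul, Matrix.charpoly_diagonal]
  simp

lemma sa_sum_eq {d : ℕ} (Q A : Matrix (Fin d) (Fin d) ℂ) (hQ : Q.IsHermitian) (hA : A.IsHermitian)
    (γ : Fin d → ℂ) (l s x : ℝ) (hu : star γ ⬝ᵥ γ = 1) (hγ : Q *ᵥ γ = (l : ℂ) • γ)
    (hAe : A = (x : ℂ) • Matrix.vecMulVec γ (star γ) + (s : ℂ) • Q) (f : ℝ → ℝ) :
    ∑ i, f (hA.eigenvalues i) + f (s * l) = ∑ i, f (s * hQ.eigenvalues i) + f (s * l + x) := by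
  have h := sa_charpoly_rank_one ((s : ℂ) • Q) γ (s * l) x hu
    (by rw [Matrix.smul_mulVec, hγ, smul_smul])
  rw [← hAe, hA.charpoly_eq, sa_charpoly_smul Q hQ] at h
  have h2 := congrArg (fun p => (p.roots.map (fun z : ℂ => f z.re)).sum) h
  have nz : ∀ g : Fin d → ℂ, ∏ i, (Polynomial.X - Polynomial.C (g i)) ≠ 0 := fun g =>
    Finset.prod_ne_zero_iff.mpr fun i _ => Polynomial.X_sub_C_ne_zero _
  rw [Polynomial.roots_mul (mul_ne_zero (nz _) (Polynomial.X_sub_C_ne_zero _)),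
    Polynomial.roots_mul (mul_ne_zero (nz _) (Polynomial.X_sub_C_ne_zero _)),
    Polynomial.roots_prod _ _ (nz _), Polynomial.roots_prod _ _ (nz _)] at h2
  simp only [Polynomial.roots_X_sub_C, Multiset.bind_singleton, Multiset.map_add, Multiset.sum_add,
    Multiset.map_map, Multiset.map_singleton, Multiset.sum_singleton] at h2
  have e1 : ((s : ℂ) * (l : ℂ)).re = s * l := by simp
  have e2 : ((s : ℂ) * (l : ℂ) + (x : ℂ)).re = s * l + x := by simp
  rw [e1, e2] at h2
  exact h2

lemma sa_ds {d : ℕ} (D : Matrix (Fin d) (Fin d) ℝ) (hD : D ∈ doublyStochastic ℝ (Fin d))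
    (w q : Fin d → ℝ) (h : Monovary w q) :
    ∑ i, w i * ∑ j, D i j * q j ≤ ∑ i, w i * q i := by
  obtain ⟨p, hp, hp1, rfl⟩ := exists_eq_sum_perm_of_mem_doublyStochastic hD
  have : ∑ i, w i * ∑ j, (∑ σ, p σ • Equiv.Perm.permMatrix ℝ σ) i j * q j =
      ∑ σ, p σ * ∑ i, w i * q (σ i) := by
    have h1 : ∀ i, ∑ j, (∑ σ, p σ • Equiv.Perm.permMatrix ℝ σ) i j * q j =
        ∑ σ, p σ * q (σ i) := by
      intro i
      simp only [Matrix.sum_apply, Matrix.smul_apply, Finset.sum_mul]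
      rw [Finset.sum_comm]
      refine Finset.sum_congr rfl fun σ _ => ?_
      simp [Equiv.Perm.permMatrix, PEquiv.toMatrix_apply]
    simp only [h1, Finset.mul_sum]
    rw [Finset.sum_comm]
    refine Finset.sum_congr rfl fun σ _ => Finset.sum_congr rfl fun i _ => by ring
  rw [this]
  calc _ ≤ ∑ σ, p σ * ∑ i, w i * q i := Finset.sum_le_sum fun σ _ =>
        mul_le_mul_of_nonneg_left h.sum_mul_comp_perm_le_sum_mul (hp σ)
    _ = _ := by rw [← Finset.sum_mul, hp1, one_mul]

lemma sa_unitary_ds {d : ℕ} (W : Matrix (Fin d) (Fin d) ℂ) (hW : W ∈ Matrix.unitaryGroup (Fin d) ℂ) :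
    (Matrix.of fun i j => Complex.normSq (W i j)) ∈ doublyStochastic ℝ (Fin d) := by
  rw [mem_doublyStochastic_iff_sum]
  refine ⟨fun i j => Complex.normSq_nonneg _, fun i => ?_, fun j => ?_⟩
  · have h := congrFun (congrFun (Matrix.mem_unitaryGroup_iff.mp hW) i) i
    simp only [Matrix.mul_apply, Matrix.star_apply, Matrix.one_apply_eq, RCLike.star_def,
      Complex.mul_conj] at h
    simpa using (by exact_mod_cast h : ∑ j, Complex.normSq (W i j) = 1)
  · have h := congrFun (congrFun (Matrix.mem_unitaryGroup_iff'.mp hW) j) j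
    simp only [Matrix.mul_apply, Matrix.star_apply, Matrix.one_apply_eq, RCLike.star_def,
      mul_comm, Complex.mul_conj] at h
    simpa using (by exact_mod_cast h : ∑ i, Complex.normSq (W i j) = 1)

/-- diagonal of Q in an orthonormal basis -/
lemma sa_diag {d : ℕ} (Q : Matrix (Fin d) (Fin d) ℂ) (hQ : Q.IsHermitian)
    (U : Matrix.unitaryGroup (Fin d) ℂ) :
    ∃ D ∈ doublyStochastic ℝ (Fin d), ∀ i,
      ((star (U : Matrix (Fin d) (Fin d) ℂ) * Q * (U : Matrix (Fin d) (Fin d) ℂ)) i i).re = ∑ j, D i j * hQ.eigenvalues j := by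
  refine ⟨_, sa_unitary_ds ((star U * hQ.eigenvectorUnitary : Matrix.unitaryGroup (Fin d) ℂ) : Matrix (Fin d) (Fin d) ℂ) (star U * hQ.eigenvectorUnitary).2, fun i => ?_⟩
  have : star (U : Matrix (Fin d) (Fin d) ℂ) * Q * (U : Matrix (Fin d) (Fin d) ℂ) =
     ((star U * hQ.eigenvectorUnitary : Matrix.unitaryGroup (Fin d) ℂ) : Matrix (Fin d) (Fin d) ℂ) *
      Matrix.diagonal (RCLike.ofReal ∘ hQ.eigenvalues) *
      star ((star U * hQ.eigenvectorUnitary : Matrix.unitaryGroup (Fin d) ℂ) : Matrix (Fin d) (Fin d) ℂ) := by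
    conv_lhs => rw [hQ.spectral_theorem, Unitary.conjStarAlgAut_apply]
    simp [mul_assoc]
  rw [this]
  generalize ((star U * hQ.eigenvectorUnitary : Matrix.unitaryGroup (Fin d) ℂ) : Matrix (Fin d) (Fin d) ℂ) = W
  rw [Matrix.mul_apply, Complex.re_sum]
  refine Finset.sum_congr rfl fun j _ => ?_
  simp [Matrix.mul_diagonal, Complex.normSq_apply]
  ring

lemma sa_tangent (a b : ℝ) (ha : 0 ≤ a) (hb : 0 < b) :
    Real.negMulLog a ≤ Real.negMulLog b + (a - b) * (-Real.log b - 1) := by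
  unfold Real.negMulLog
  rcases ha.eq_or_lt with rfl | ha
  · simp; nlinarith
  have h := Real.log_le_sub_one_of_pos (div_pos hb ha)
  rw [Real.log_div hb.ne' ha.ne'] at h
  have := mul_le_mul_of_nonneg_left h ha.le
  have e : a * (b / a - 1) = b - a := by field_simp
  rw [e] at this
  nlinarith

lemma sa_scalar {d : ℕ} (a b : Fin d → ℝ) (ha : ∀ i, 0 ≤ a i) (hb : ∀ i, 0 ≤ b i)
    (hs : ∑ i, a i = ∑ i, b i)
    (h : ∀ w : Fin d → ℝ, (∀ i j, b i ≤ b j → w i ≤ w j) → ∑ i, w i * b i ≤ ∑ i, w i * a i) :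
    ∑ i, Real.negMulLog (a i) ≤ ∑ i, Real.negMulLog (b i) := by
  have key : ∀ ε > 0, ∑ i, Real.negMulLog (a i + ε) ≤ ∑ i, Real.negMulLog (b i + ε) := by
    intro ε hε
    have h1 := h (fun i => Real.log (b i + ε))
      (fun i j hij => Real.log_le_log (by linarith [hb i]) (by linarith))
    calc _ ≤ ∑ i, (Real.negMulLog (b i + ε) + ((a i + ε) - (b i + ε)) *
            (-Real.log (b i + ε) - 1)) := Finset.sum_le_sum fun i _ =>
          sa_tangent _ _ (by linarith [ha i]) (by linarith [hb i])
      _ = ∑ i, Real.negMulLog (b i + ε) + (∑ i, Real.log (b i + ε) * b i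
            - ∑ i, Real.log (b i + ε) * a i + (∑ i, b i - ∑ i, a i)) := by
          rw [← Finset.sum_sub_distrib, ← Finset.sum_sub_distrib, ← Finset.sum_add_distrib,
            ← Finset.sum_add_distrib]
          exact Finset.sum_congr rfl fun i _ => by ring
      _ ≤ _ := by linarith
  have lim : ∀ c : Fin d → ℝ, Filter.Tendsto (fun ε => ∑ i, Real.negMulLog (c i + ε))
      (nhdsWithin 0 (Set.Ioi 0)) (nhds (∑ i, Real.negMulLog (c i))) := by
    intro c
    have : Continuous (fun ε => ∑ i, Real.negMulLog (c i + ε)) :=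
      continuous_finsetSum _ fun i _ => Real.continuous_negMulLog.comp (by fun_prop)
    have := (this.tendsto 0).mono_left (nhdsWithin_le_nhds (s := Set.Ioi 0))
    simpa using this
  exact le_of_tendsto_of_tendsto (lim a) (lim b)
    (Filter.eventually_of_mem self_mem_nhdsWithin key)

lemma sa_entropy {d : ℕ} (A : Matrix (Fin d) (Fin d) ℂ) (h : A.IsHermitian) :
    vnEntropy A = (∑ i, Real.negMulLog (h.eigenvalues i)) / Real.log 2 := by
  rw [vnEntropy, dif_pos h, Finset.sum_div, ← Finset.sum_neg_distrib]
  exact Finset.sum_congr rfl fun i _ => by simp [Real.negMulLog, Real.logb]; ring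


lemma sa_order (d : ℕ) : ∃ e : Fin d ≃ Fin (Fintype.card (Fin d)),
    ∀ (A : Matrix (Fin d) (Fin d) ℂ) (h : A.IsHermitian) (i j : Fin d), e i ≤ e j →
      h.eigenvalues j ≤ h.eigenvalues i :=
  ⟨_, fun _ h _ _ hij => h.eigenvalues₀_antitone hij⟩

lemma sa_sum_eig {d : ℕ} (A : Matrix (Fin d) (Fin d) ℂ) (h : A.IsHermitian) (ht : A.trace = 1) :
    ∑ i, h.eigenvalues i = 1 := by
  rw [h.trace_eq_sum_eigenvalues] at ht
  have h2 := congrArg Complex.re ht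
  simpa using h2

/-- Spin alignment conjecture, case n = 1, arbitrary dimension: among all density
matrices ω, the entropy S(x·ω + (1−x)·Q) is minimized at ω = γγ†, where γ is a top
eigenvector of Q. -/
theorem stmt9 (d : ℕ) (Q : Matrix (Fin d) (Fin d) ℂ)
    (hQ : Q.PosSemidef) (hQtr : Q.trace = 1)
    (lmax : ℝ) (γ : Fin d → ℂ)
    (hγunit : ∑ i, Complex.normSq (γ i) = 1)
    (hγeig : Q *ᵥ γ = (lmax : ℂ) • γ)
    (hlmax : ∀ (v : Fin d → ℂ) (c : ℝ), v ≠ 0 → Q *ᵥ v = (c : ℂ) • v → c ≤ lmax)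
    (x : ℝ) (hx : x ∈ Set.Icc (0 : ℝ) 1)
    (ω : Matrix (Fin d) (Fin d) ℂ) (hω : ω.PosSemidef) (hωtr : ω.trace = 1) :
    vnEntropy ((x : ℂ) • Matrix.vecMulVec γ (star γ) + ((1 - x : ℝ) : ℂ) • Q) ≤
      vnEntropy ((x : ℂ) • ω + ((1 - x : ℝ) : ℂ) • Q) := by
  obtain ⟨hx0, hx1⟩ := hx
  have hx1' : 0 ≤ 1 - x := by linarith
  have hu : star γ ⬝ᵥ γ = 1 := by
    have : ((∑ i, Complex.normSq (γ i) : ℝ) : ℂ) = 1 := by rw [hγunit]; simp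
    rw [← this]
    simp [dotProduct, Complex.normSq_eq_conj_mul_self]
  have hγ0 : γ ≠ 0 := by
    rintro rfl
    simp at hγunit
  have hs1 : ∀ r : ℝ, star (r : ℂ) = r := fun r => Complex.conj_ofReal r
  have hAH : ((x : ℂ) • Matrix.vecMulVec γ (star γ) + ((1 - x : ℝ) : ℂ) • Q).IsHermitian := by
    unfold Matrix.IsHermitian
    rw [Matrix.conjTranspose_add, Matrix.conjTranspose_smul, Matrix.conjTranspose_smul, hs1, hs1,
      hQ.1.eq, Matrix.conjTranspose_vecMulVec, star_star]
  have hx0c : (0 : ℂ) ≤ (x : ℂ) := by exact_mod_cast hx0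
  have hx1c : (0 : ℂ) ≤ ((1 - x : ℝ) : ℂ) := by exact_mod_cast hx1'
  have hBP : ((x : ℂ) • ω + ((1 - x : ℝ) : ℂ) • Q).PosSemidef :=
    (hω.smul hx0c).add (hQ.smul hx1c)
  have hBH := hBP.1
  have hBtr : ((x : ℂ) • ω + ((1 - x : ℝ) : ℂ) • Q).trace = 1 := by
    rw [Matrix.trace_add, Matrix.trace_smul, Matrix.trace_smul, hQtr, hωtr]
    simp
  rw [sa_entropy _ hAH, sa_entropy _ hBH]
  refine div_le_div_of_nonneg_right ?_ (Real.log_nonneg (by norm_num))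
  obtain ⟨e, he⟩ := sa_order d
  have hd : 0 < Fintype.card (Fin d) := by
    rcases Nat.eq_zero_or_pos d with rfl | h
    · simp at hγunit
    · simpa using h
  obtain ⟨i0, hi0⟩ : ∃ i0 : Fin d, ∀ i, e i0 ≤ e i :=
    ⟨e.symm ⟨0, hd⟩, fun i => by rw [Equiv.apply_symm_apply]; exact Fin.mk_le_of_le_val (Nat.zero_le _)⟩
  have hl : lmax = hQ.1.eigenvalues i0 := by
    apply le_antisymm
    · have h1 := hQ.1.charpoly_eq
      have h2 : Q.charpoly.eval (lmax : ℂ) = 0 := by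
        rw [Matrix.eval_charpoly]
        refine Matrix.exists_mulVec_eq_zero_iff.mp ⟨γ, hγ0, ?_⟩
        rw [Matrix.sub_mulVec, hγeig]
        ext i; simp [Matrix.scalar_apply, Matrix.mulVec_diagonal]
      rw [h1, Polynomial.eval_prod, Finset.prod_eq_zero_iff] at h2
      obtain ⟨j, -, hj⟩ := h2
      simp only [Polynomial.eval_sub, Polynomial.eval_X, Polynomial.eval_C, sub_eq_zero] at hj
      have hj' : lmax = hQ.1.eigenvalues j := by simpa using congrArg Complex.re hj
      rw [hj']
      exact he Q hQ.1 _ _ (hi0 j)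
    · refine hlmax (hQ.1.eigenvectorBasis i0) _ ?_ ?_
      · intro h0
        apply hQ.1.eigenvectorBasis.orthonormal.ne_zero i0
        ext i; exact congrFun h0 i
      · rw [hQ.1.mulVec_eigenvectorBasis]
        ext i; simp
  set q := hQ.1.eigenvalues with hq
  set b := hBH.eigenvalues with hb
  have hqs : ∑ i, q i = 1 := sa_sum_eig Q hQ.1 hQtr
  have hbs : ∑ i, b i = 1 := sa_sum_eig _ hBH hBtr
  have hos : ∑ i, hω.1.eigenvalues i = 1 := sa_sum_eig _ hω.1 hωtr
  let a : Fin d → ℝ := fun i => (1 - x) * q i + if i = i0 then x else 0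
  have hsum : ∑ i, Real.negMulLog (hAH.eigenvalues i) = ∑ i, Real.negMulLog (a i) := by
    have h := sa_sum_eq Q _ hQ.1 hAH γ lmax (1 - x) x hu hγeig rfl Real.negMulLog
    rw [hl, ← hq, ← Finset.add_sum_erase Finset.univ (fun i => Real.negMulLog ((1 - x) * q i))
      (Finset.mem_univ i0)] at h
    rw [← Finset.add_sum_erase Finset.univ (fun i => Real.negMulLog (a i)) (Finset.mem_univ i0)]
    have h3 : ∑ i ∈ Finset.univ.erase i0, Real.negMulLog (a i) =
        ∑ i ∈ Finset.univ.erase i0, Real.negMulLog ((1 - x) * q i) :=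
      Finset.sum_congr rfl fun i hi => by simp [a, Finset.ne_of_mem_erase hi]
    have h4 : a i0 = (1 - x) * q i0 + x := by simp [a]
    rw [h3, h4]
    linarith
  rw [hsum]
  apply sa_scalar
  · intro i
    have := mul_nonneg hx1' (hQ.eigenvalues_nonneg i)
    simp only [a]
    split_ifs <;> linarith
  · exact fun i => hBP.eigenvalues_nonneg i
  · rw [hbs, Finset.sum_add_distrib, ← Finset.mul_sum, hqs]
    simp
  · intro w hw
    obtain ⟨D, hD, hDq⟩ := sa_diag Q hQ.1 hBH.eigenvectorUnitary
    obtain ⟨E, hE, hEo⟩ := sa_diag ω hω.1 hBH.eigenvectorUnitary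
    have hbi : ∀ i, b i = x * ∑ j, E i j * hω.1.eigenvalues j + (1 - x) * ∑ j, D i j * q j := by
      intro i
      have h := congrFun (congrFun hBH.conjStarAlgAut_star_eigenvectorUnitary i) i
      rw [Unitary.conjStarAlgAut_star_apply, mul_add, add_mul, Matrix.mul_smul, Matrix.mul_smul,
        Matrix.smul_mul, Matrix.smul_mul] at h
      have h := congrArg Complex.re h
      rw [Matrix.add_apply, Complex.add_re, Matrix.smul_apply, Matrix.smul_apply, smul_eq_mul,
        smul_eq_mul, Complex.re_ofReal_mul, Complex.re_ofReal_mul, hDq, hEo] at h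
      rw [h]
      simp [hb]
    have hmono : Monovary w q := by
      intro i j hij
      apply hw
      apply he
      by_contra hc
      exact absurd (he Q hQ.1 i j (not_le.mp hc).le) (not_le.mpr hij)
    have h1 := sa_ds D hD w q hmono
    have h2 : ∑ i, w i * ∑ j, E i j * hω.1.eigenvalues j ≤ w i0 := by
      calc _ ≤ ∑ i, w i0 * ∑ j, E i j * hω.1.eigenvalues j :=
            Finset.sum_le_sum fun i _ => mul_le_mul_of_nonneg_right
              (hw _ _ (he _ hBH _ _ (hi0 i)))
              (Finset.sum_nonneg fun j _ => mul_nonneg (hE.1 i j) (hω.eigenvalues_nonneg j))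
        _ = w i0 := by
            rw [← Finset.mul_sum, Finset.sum_comm]
            simp only [← Finset.sum_mul, sum_col_of_mem_doublyStochastic hE, one_mul, hos, mul_one]
    calc ∑ i, w i * b i = x * ∑ i, w i * ∑ j, E i j * hω.1.eigenvalues j +
          (1 - x) * ∑ i, w i * ∑ j, D i j * q j := by
          rw [Finset.mul_sum, Finset.mul_sum, ← Finset.sum_add_distrib]
          exact Finset.sum_congr rfl fun i _ => by rw [hbi]; ring
      _ ≤ x * w i0 + (1 - x) * ∑ i, w i * q i :=
          add_le_add (mul_le_mul_of_nonneg_left h2 hx0) (mul_le_mul_of_nonneg_left h1 hx1')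
      _ = ∑ i, w i * a i := by
          simp only [a, mul_add, Finset.sum_add_distrib, mul_ite, mul_zero, Finset.sum_ite_eq',
            Finset.mem_univ, if_true, Finset.mul_sum]
          rw [add_comm, mul_comm x]
          congr 1
          exact Finset.sum_congr rfl fun i _ => by ring
end

section
/- (Rényi-entropy version of the one-spin alignment minimization.) Let α ∈ (0,1) ∪ (1,∞), let Q be a density matrix on ℂ^d, let λ_max be its largest eigenvalue, let γ ∈ ℂ^d be a unit vector with Qγ = λ_max·γ, and let u ∈ [0,1]. Then for every density matrix σ on ℂ^d, S_α(u·γγ† + (1−u)·Q) ≤ S_α(u·σ + (1−u)·Q). -/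
open Matrix ComplexOrder

/-- Rényi-α entropy (base-2) of a matrix: (1/(1−α))·log₂ ∑ λᵢ^α over its eigenvalues
(0 if the matrix is not Hermitian; 0^α = 0 via `Real.rpow`). -/
noncomputable def renyiEntropy {n : ℕ} (α : ℝ) (ρ : Matrix (Fin n) (Fin n) ℂ) : ℝ :=
  if h : ρ.IsHermitian then
    (1 / (1 - α)) * Real.logb 2 (∑ i, (h.eigenvalues i) ^ α) else 0


lemma rpow_tangent_ge {α x y : ℝ} (hα : 1 < α) (hx : 0 < x) (hy : 0 ≤ y) :
    α * x ^ (α - 1) * (y - x) ≤ y ^ α - x ^ α := by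
  have h := one_add_mul_self_le_rpow_one_add (s := y / x - 1)
    (by have := div_nonneg hy hx.le; linarith) hα.le
  have h2 : (1 + (y / x - 1)) ^ α = y ^ α / x ^ α := by
    rw [← Real.div_rpow hy hx.le]; congr 1; ring
  rw [h2, le_div_iff₀ (Real.rpow_pos_of_pos hx _)] at h
  have h3 : x ^ α = x ^ (α - 1) * x := by
    rw [Real.rpow_sub_one hx.ne']; field_simp
  have h4 : (1 + α * (y / x - 1)) * x ^ α = x ^ α + α * x ^ (α - 1) * (y - x) := by
    rw [h3]; field_simp; try ring
  linarith

lemma rpow_tangent_le {α x y : ℝ} (hα0 : 0 < α) (hα : α < 1) (hx : 0 < x) (hy : 0 ≤ y) :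
    y ^ α - x ^ α ≤ α * x ^ (α - 1) * (y - x) := by
  have h := rpow_one_add_le_one_add_mul_self (s := y / x - 1)
    (by have := div_nonneg hy hx.le; linarith) hα0.le hα.le
  have h2 : (1 + (y / x - 1)) ^ α = y ^ α / x ^ α := by
    rw [← Real.div_rpow hy hx.le]; congr 1; ring
  rw [h2, div_le_iff₀ (Real.rpow_pos_of_pos hx _)] at h
  have h3 : x ^ α = x ^ (α - 1) * x := by
    rw [Real.rpow_sub_one hx.ne']; field_simp
  have h4 : (1 + α * (y / x - 1)) * x ^ α = x ^ α + α * x ^ (α - 1) * (y - x) := by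
    rw [h3]; field_simp; try ring
  linarith

lemma sum_core {n : ℕ} (g : ℝ → ℝ) (m : ℝ) (a b : Fin (n+1) → ℝ)
    (ha : ∀ i, 0 ≤ a i) (hb : Antitone b) (hab : ∀ i, i ≠ 0 → a i ≤ b i)
    (h0 : b 0 ≤ a 0) (hs : ∑ i, a i = ∑ i, b i)
    (h1 : ∀ x y, 0 ≤ x → x ≤ y → y ≤ b 0 → g y - g x ≤ m * (y - x))
    (h2 : ∀ y, b 0 ≤ y → m * (y - b 0) ≤ g y - g (b 0)) :
    ∑ i, g (b i) ≤ ∑ i, g (a i) := by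
  rw [Fin.sum_univ_succ, Fin.sum_univ_succ] at *
  have h3 := h2 _ h0
  have h4 : ∑ i : Fin n, (g (b i.succ) - g (a i.succ)) ≤
      ∑ i : Fin n, m * (b i.succ - a i.succ) :=
    Finset.sum_le_sum fun i _ => h1 _ _ (ha _) (hab _ (Fin.succ_ne_zero i)) (hb (Fin.zero_le _))
  rw [← Finset.mul_sum, Finset.sum_sub_distrib, Finset.sum_sub_distrib] at h4
  have h5 : ∑ i : Fin n, b i.succ - ∑ i : Fin n, a i.succ = a 0 - b 0 := by linarith
  rw [h5] at h4
  linarith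

lemma sum_rpow_gt {n : ℕ} {α : ℝ} (hα : 1 < α) (a b : Fin (n+1) → ℝ)
    (ha : ∀ i, 0 ≤ a i) (hb : Antitone b) (hab : ∀ i, i ≠ 0 → a i ≤ b i)
    (h0 : b 0 ≤ a 0) (hb0 : 0 < b 0) (hs : ∑ i, a i = ∑ i, b i) :
    ∑ i, (b i) ^ α ≤ ∑ i, (a i) ^ α := by
  refine sum_core (fun x => x ^ α) (α * b 0 ^ (α - 1)) a b ha hb hab h0 hs ?_ ?_
  · intro x y hx hxy hy
    rcases hxy.eq_or_lt with rfl | hlt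
    · simp
    have hy0 : 0 < y := by linarith
    have h := rpow_tangent_ge hα hy0 hx
    have h' : y ^ (α - 1) ≤ b 0 ^ (α - 1) := Real.rpow_le_rpow hy0.le hy (by linarith)
    have : α * y ^ (α - 1) * (y - x) ≤ α * b 0 ^ (α - 1) * (y - x) := by
      have : 0 ≤ y - x := by linarith
      gcongr
    linarith
  · intro y hy
    exact rpow_tangent_ge hα hb0 (by linarith)

lemma sum_rpow_lt {n : ℕ} {α : ℝ} (hα0 : 0 < α) (hα : α < 1) (a b : Fin (n+1) → ℝ)
    (ha : ∀ i, 0 ≤ a i) (hb : Antitone b) (hab : ∀ i, i ≠ 0 → a i ≤ b i)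
    (h0 : b 0 ≤ a 0) (hb0 : 0 < b 0) (hs : ∑ i, a i = ∑ i, b i) :
    ∑ i, (a i) ^ α ≤ ∑ i, (b i) ^ α := by
  have := sum_core (fun x => -x ^ α) (-(α * b 0 ^ (α - 1))) a b ha hb hab h0 hs ?_ ?_
  · simp only [Finset.sum_neg_distrib] at this
    linarith
  · intro x y hx hxy hy
    rcases hxy.eq_or_lt with rfl | hlt
    · simp
    have hy0 : 0 < y := by linarith
    have h := rpow_tangent_le hα0 hα hy0 hx
    have h' : b 0 ^ (α - 1) ≤ y ^ (α - 1) :=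
      Real.rpow_le_rpow_of_nonpos hy0 hy (by linarith)
    have : α * b 0 ^ (α - 1) * (y - x) ≤ α * y ^ (α - 1) * (y - x) := by
      have : 0 ≤ y - x := by linarith
      gcongr
    linarith
  · intro y hy
    have := rpow_tangent_le hα0 hα hb0 (hb0.le.trans hy)
    linarith

section abstractE
variable {E : Type*} [NormedAddCommGroup E] [InnerProductSpace ℂ E]

lemma quad_eq {ι : Type*} [Fintype ι] (w : OrthonormalBasis ι ℂ E) (t : ι → ℝ) (T : E →ₗ[ℂ] E)
    (hT : ∀ i, T (w i) = (t i : ℂ) • w i) (x : E) :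
    (inner ℂ x (T x)).re = ∑ i, t i * ‖inner ℂ (w i) x‖ ^ 2 := by
  have h : T x = ∑ i, (inner ℂ (w i) x * (t i : ℂ)) • w i := by
    conv_lhs => rw [← w.sum_repr' x]
    simp only [map_sum, map_smul, hT, smul_smul]
  rw [h, inner_sum, Complex.re_sum]
  refine Finset.sum_congr rfl fun i _ => ?_
  rw [inner_smul_right, ← inner_conj_symm x (w i), mul_right_comm, Complex.mul_conj,
    Complex.normSq_eq_norm_sq, ← Complex.ofReal_mul, Complex.ofReal_re, mul_comm]

lemma quad_le {ι : Type*} [Fintype ι] (w : OrthonormalBasis ι ℂ E) (t : ι → ℝ) (T : E →ₗ[ℂ] E)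
    (hT : ∀ i, T (w i) = (t i : ℂ) • w i) (x : E) (s : ℝ)
    (h : ∀ i, inner ℂ (w i) x ≠ 0 → t i ≤ s) :
    (inner ℂ x (T x)).re ≤ s * ‖x‖ ^ 2 := by
  rw [quad_eq w t T hT, ← w.sum_sq_norm_inner_right x, Finset.mul_sum]
  refine Finset.sum_le_sum fun i _ => ?_
  by_cases h0 : inner ℂ (w i) x = 0
  · simp [h0]
  · exact mul_le_mul_of_nonneg_right (h i h0) (by positivity)

lemma le_quad {ι : Type*} [Fintype ι] (w : OrthonormalBasis ι ℂ E) (t : ι → ℝ) (T : E →ₗ[ℂ] E)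
    (hT : ∀ i, T (w i) = (t i : ℂ) • w i) (x : E) (s : ℝ)
    (h : ∀ i, inner ℂ (w i) x ≠ 0 → s ≤ t i) :
    s * ‖x‖ ^ 2 ≤ (inner ℂ x (T x)).re := by
  rw [quad_eq w t T hT, ← w.sum_sq_norm_inner_right x, Finset.mul_sum]
  refine Finset.sum_le_sum fun i _ => ?_
  by_cases h0 : inner ℂ (w i) x = 0
  · simp [h0]
  · exact mul_le_mul_of_nonneg_right (h i h0) (by positivity)

lemma weyl {d : ℕ} (w v : OrthonormalBasis (Fin d) ℂ E) (c b : Fin d → ℝ) (C B : E →ₗ[ℂ] E)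
    (hC : ∀ i, C (w i) = (c i : ℂ) • w i) (hB : ∀ i, B (v i) = (b i : ℂ) • v i)
    (hCB : ∀ x, (inner ℂ x (C x)).re ≤ (inner ℂ x (B x)).re)
    (j : Fin d) (s : ℝ) (hs : ∀ i ≤ j, s ≤ c i) (hb : Antitone b) : s ≤ b j := by
  let φ : E →ₗ[ℂ] ({i : Fin d // i ≠ j} → ℂ) :=
    LinearMap.pi fun i => if i.1 < j then (innerSL ℂ (v i)).toLinearMap
      else (innerSL ℂ (w i)).toLinearMap
  have : FiniteDimensional ℂ E := v.toBasis.finiteDimensional_of_finite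
  have hd : Module.finrank ℂ E = d := by
    simpa using Module.finrank_eq_card_basis v.toBasis
  have hker : LinearMap.ker φ ≠ ⊥ := by
    apply LinearMap.ker_ne_bot_of_finrank_lt
    rw [hd, Module.finrank_fintype_fun_eq_card]
    have := Fintype.card_subtype_lt (p := fun i : Fin d => i ≠ j) (x := j) (by simp)
    simpa using this
  obtain ⟨x, hx, hx0⟩ := (Submodule.ne_bot_iff _).1 hker
  have hφ : ∀ i : Fin d, i ≠ j → (if i < j then inner ℂ (v i) x else inner ℂ (w i) x) = 0 := by
    intro i hi
    have := congrFun (LinearMap.mem_ker.1 hx) ⟨i, hi⟩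
    simp only [φ, LinearMap.pi_apply] at this
    split_ifs at this ⊢ <;> simpa using this
  have h1 := le_quad w c C hC x s (fun i hi => hs i (by
    by_contra hlt
    push Not at hlt
    have := hφ i hlt.ne'
    rw [if_neg hlt.not_gt] at this
    exact hi this))
  have h2 := quad_le v b B hB x (b j) (fun i hi => hb (by
    by_contra hlt
    push Not at hlt
    have := hφ i hlt.ne
    rw [if_pos hlt] at this
    exact hi this))
  have h3 := hCB x
  have : 0 < ‖x‖ ^ 2 := by have := norm_pos_iff.2 hx0; positivity
  nlinarith

lemma eig_sorted {d : ℕ} {M : Matrix (Fin d) (Fin d) ℂ} (hM : M.IsHermitian) :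
    ∃ (e : Fin d ≃ Fin d) (w : OrthonormalBasis (Fin d) ℂ (EuclideanSpace ℂ (Fin d))),
      Antitone (fun i => hM.eigenvalues (e i)) ∧
      ∀ i, Matrix.toEuclideanLin M (w i) = (hM.eigenvalues (e i) : ℂ) • w i := by
  refine ⟨Tuple.sort (fun i => - hM.eigenvalues i),
    hM.eigenvectorBasis.reindex (Tuple.sort (fun i => - hM.eigenvalues i)).symm, ?_, ?_⟩
  · intro i j hij
    have := Tuple.monotone_sort (fun i => - hM.eigenvalues i) hij
    simpa using this
  · intro i
    have := hM.mulVec_eigenvectorBasis (Tuple.sort (fun i => - hM.eigenvalues i) i)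
    ext k
    have := congrFun this k
    simpa [Matrix.toLpLin_apply] using this

lemma inner_eig {ι : Type*} [Fintype ι] (w : OrthonormalBasis ι ℂ E) (t : ι → ℝ) (T : E →ₗ[ℂ] E)
    (hT : ∀ i, T (w i) = (t i : ℂ) • w i) (x : E) (i : ι) :
    inner ℂ (w i) (T x) = (t i : ℂ) * inner ℂ (w i) x := by
  classical
  have h : T x = ∑ i, (inner ℂ (w i) x * (t i : ℂ)) • w i := by
    conv_lhs => rw [← w.sum_repr' x]
    simp only [map_sum, map_smul, hT, smul_smul]
  rw [h, inner_sum]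
  simp_rw [inner_smul_right, w.inner_eq_ite]
  simp [mul_comm]

lemma spec_struct {n : ℕ} (w : OrthonormalBasis (Fin (n+1)) ℂ E) (a : Fin (n+1) → ℝ)
    (A C : E →ₗ[ℂ] E) (g : E) (u c0 : ℝ) (hu : 0 < u) (hg : ‖g‖ = 1)
    (hA : ∀ x, A x = C x + ((u : ℂ) * inner ℂ g x) • g) (hCg : C g = (c0 : ℂ) • g)
    (hC : ∀ x, (inner ℂ x (C x)).re ≤ c0 * ‖x‖ ^ 2)
    (hw : ∀ i, A (w i) = (a i : ℂ) • w i) (ha : Antitone a) :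
    a 0 = c0 + u ∧ C (w 0) = (c0 : ℂ) • w 0 ∧
      ∀ i, i ≠ 0 → C (w i) = (a i : ℂ) • w i ∧ a i ≤ c0 := by
  have hAg : A g = ((c0 + u : ℝ) : ℂ) • g := by
    rw [hA, hCg, inner_self_eq_norm_sq_to_K, hg, ← add_smul]
    simp
  have hne : ∀ i, inner ℂ (w i) g ≠ 0 → a i = c0 + u := by
    intro i hi
    have h := inner_eig w a A hw g i
    rw [hAg, inner_smul_right] at h
    exact_mod_cast (mul_right_cancel₀ hi h).symm
  have hle : ∀ i, a i ≤ c0 + u * ‖inner ℂ (w i) g‖ ^ 2 := by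
    intro i
    have h1 := hC (w i)
    have h2 : (inner ℂ (w i) (A (w i))).re = a i := by
      rw [hw, inner_smul_right, inner_self_eq_norm_sq_to_K]; simp
    rw [hA, inner_add_right, inner_smul_right, ← inner_conj_symm g (w i), mul_assoc,
      Complex.conj_mul'] at h2
    rw [w.norm_eq_one] at h1
    have h3 : ((u : ℂ) * (‖inner ℂ (w i) g‖ : ℂ) ^ 2).re = u * ‖inner ℂ (w i) g‖ ^ 2 := by
      norm_cast
    rw [Complex.add_re, h3] at h2
    linarith
  have hP := w.sum_sq_norm_inner_right g
  rw [hg, one_pow] at hP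
  obtain ⟨k, hk⟩ : ∃ k, inner ℂ (w k) g ≠ 0 := by
    by_contra! hcon
    simp [hcon] at hP
  have hk1 : 1 ≤ ‖inner ℂ (w k) g‖ ^ 2 := by
    have h1 := hne k hk
    have h2 := hle k
    nlinarith
  have hoth : ∀ i, i ≠ k → inner ℂ (w i) g = 0 := by
    intro i hi
    have h := Finset.add_le_sum (s := Finset.univ)
      (f := fun i => ‖inner ℂ (w i) g‖ ^ 2) (fun i _ => by positivity)
      (Finset.mem_univ i) (Finset.mem_univ k) hi
    simp only [hP] at h
    have h0 : ‖inner ℂ (w i) g‖ ^ 2 ≤ 0 := by linarith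
    have : ‖inner ℂ (w i) g‖ = 0 := by nlinarith [norm_nonneg (inner ℂ (w i) g)]
    exact norm_eq_zero.1 this
  have hothC : ∀ i, i ≠ k → C (w i) = (a i : ℂ) • w i ∧ a i ≤ c0 := by
    intro i hi
    constructor
    · rw [← hw, hA, ← inner_conj_symm g (w i), hoth i hi]; simp
    · have := hle i
      rw [hoth i hi] at this
      simpa using this
  have hk0 : k = 0 := by
    by_contra hk0
    have h1 := (hothC 0 (Ne.symm hk0)).2
    have h2 := ha (Fin.zero_le k)
    have h3 := hne k hk
    linarith
  subst hk0
  refine ⟨hne _ hk, ?_, hothC⟩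
  have hgw : g = inner ℂ (w 0) g • w 0 := by
    conv_lhs => rw [← w.sum_repr' g]
    rw [Finset.sum_eq_single 0]
    · intro i _ hi; rw [hoth i hi, zero_smul]
    · simp
  have hwg : w 0 = (inner ℂ (w 0) g)⁻¹ • g := by
    conv_rhs => rw [hgw]
    rw [inner_smul_right, inner_self_eq_norm_sq_to_K, w.norm_eq_one, smul_smul]
    simp [hk]
  rw [hwg, map_smul, hCg, smul_comm]

end abstractE

lemma eig_basis_apply {d : ℕ} {M : Matrix (Fin d) (Fin d) ℂ} (hM : M.IsHermitian) (i : Fin d) :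
    Matrix.toEuclideanLin M (hM.eigenvectorBasis i) =
      (hM.eigenvalues i : ℂ) • hM.eigenvectorBasis i := by
  have := hM.mulVec_eigenvectorBasis i
  ext k
  have := congrFun this k
  simpa [Matrix.toLpLin_apply] using this

lemma sum_eig {d : ℕ} {M : Matrix (Fin d) (Fin d) ℂ} (hM : M.IsHermitian) (h : M.trace = 1) :
    ∑ i, hM.eigenvalues i = 1 := by
  have := hM.trace_eq_sum_eigenvalues
  rw [h] at this
  have h2 := congrArg Complex.re this
  rw [Complex.re_sum] at h2
  simpa using h2.symm

set_option maxHeartbeats 1000000 in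
lemma stmt_core
    (d : ℕ) (Q : Matrix (Fin d) (Fin d) ℂ)
    (hQ : Q.PosSemidef) (hQtr : Q.trace = 1)
    (lmax : ℝ) (γ : Fin d → ℂ)
    (hγunit : ∑ i, Complex.normSq (γ i) = 1)
    (hγeig : Q *ᵥ γ = (lmax : ℂ) • γ)
    (hlmax : ∀ (v : Fin d → ℂ) (c : ℝ), v ≠ 0 → Q *ᵥ v = (c : ℂ) • v → c ≤ lmax)
    (u : ℝ) (hu0 : 0 < u) (hu1 : u ≤ 1)
    (σ : Matrix (Fin d) (Fin d) ℂ) (hσ : σ.PosSemidef) (hσtr : σ.trace = 1)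
    (A B : Matrix (Fin d) (Fin d) ℂ)
    (hAdef : A = (u : ℂ) • Matrix.vecMulVec γ (star γ) + ((1 - u : ℝ) : ℂ) • Q)
    (hBdef : B = (u : ℂ) • σ + ((1 - u : ℝ) : ℂ) • Q)
    (hA : A.PosSemidef) (hB : B.PosSemidef) :
    0 < ∑ i, (hA.1.eigenvalues i) ^ (1 : ℝ) ∧
    (∀ α : ℝ, 0 < ∑ i, (hA.1.eigenvalues i) ^ α) ∧ (∀ α : ℝ, 0 < ∑ i, (hB.1.eigenvalues i) ^ α) ∧
    (∀ α : ℝ, 1 < α → ∑ i, (hB.1.eigenvalues i) ^ α ≤ ∑ i, (hA.1.eigenvalues i) ^ α) ∧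
    (∀ α : ℝ, 0 < α → α < 1 →
      ∑ i, (hA.1.eigenvalues i) ^ α ≤ ∑ i, (hB.1.eigenvalues i) ^ α) := by
  obtain ⟨n, rfl⟩ : ∃ n, d = n + 1 := by
    rcases d with _ | n
    · simp at hγunit
    · exact ⟨n, rfl⟩
  set g : EuclideanSpace ℂ (Fin (n+1)) := WithLp.toLp 2 γ with hg
  have hgn : ‖g‖ = 1 := by
    rw [EuclideanSpace.norm_eq, Real.sqrt_eq_one]
    simpa [Complex.normSq_eq_norm_sq] using hγunit
  have hQg : Matrix.toEuclideanLin Q g = (lmax : ℂ) • g := by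
    rw [hg, Matrix.toLpLin_toLp, Matrix.toLin'_apply, hγeig]; rfl
  have hγγ : ∀ x, Matrix.toEuclideanLin (Matrix.vecMulVec γ (star γ)) x = inner ℂ g x • g := by
    intro x
    ext k
    simp [Matrix.toLpLin_apply, Matrix.vecMulVec_mulVec, hg, EuclideanSpace.inner_eq_star_dotProduct,
      dotProduct_comm, mul_comm]
  have hQle : ∀ i, hQ.1.eigenvalues i ≤ lmax := by
    intro i
    refine hlmax (WithLp.ofLp (hQ.1.eigenvectorBasis i)) _ ?_ ?_
    · intro h0
      have h1 := hQ.1.eigenvectorBasis.norm_eq_one i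
      have h2 : hQ.1.eigenvectorBasis i = 0 := by
        ext k; simpa using congrFun h0 k
      simp [h2] at h1
    · simpa using hQ.1.mulVec_eigenvectorBasis i
  have hQq : ∀ x, (inner ℂ x (Matrix.toEuclideanLin Q x)).re ≤ lmax * ‖x‖ ^ 2 := fun x =>
    quad_le hQ.1.eigenvectorBasis _ _ (eig_basis_apply hQ.1) x _ fun i _ => hQle i
  have hσ0 : ∀ x, 0 ≤ (inner ℂ x (Matrix.toEuclideanLin σ x)).re := fun x => by
    simpa using le_quad hσ.1.eigenvectorBasis _ _ (eig_basis_apply hσ.1) x 0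
      fun i _ => hσ.eigenvalues_nonneg i
  have hσ1 : ∀ x, (inner ℂ x (Matrix.toEuclideanLin σ x)).re ≤ ‖x‖ ^ 2 := fun x => by
    simpa using quad_le hσ.1.eigenvectorBasis _ _ (eig_basis_apply hσ.1) x 1
      fun i _ => by
        rw [← sum_eig hσ.1 hσtr]
        exact Finset.single_le_sum (fun i _ => hσ.eigenvalues_nonneg i) (Finset.mem_univ i)
  have hγtr : (Matrix.vecMulVec γ (star γ)).trace = 1 := by
    rw [Matrix.trace_vecMulVec]
    simp only [dotProduct, Pi.star_apply, Complex.star_def, Complex.mul_conj]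
    exact_mod_cast hγunit
  have hAtr : A.trace = 1 := by
    rw [hAdef, Matrix.trace_add, Matrix.trace_smul, Matrix.trace_smul, hγtr, hQtr]; simp
  have hBtr : B.trace = 1 := by
    rw [hBdef, Matrix.trace_add, Matrix.trace_smul, Matrix.trace_smul, hσtr, hQtr]; simp
  obtain ⟨ea, w, hwa, hw⟩ := eig_sorted hA.1
  obtain ⟨eb, v, hvb, hv⟩ := eig_sorted hB.1
  have hsa : ∑ i, hA.1.eigenvalues (ea i) = 1 := by
    rw [Equiv.sum_comp ea hA.1.eigenvalues, sum_eig hA.1 hAtr]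
  have hsb : ∑ i, hB.1.eigenvalues (eb i) = 1 := by
    rw [Equiv.sum_comp eb hB.1.eigenvalues, sum_eig hB.1 hBtr]
  have ha0 : ∀ i, 0 ≤ hA.1.eigenvalues (ea i) := fun i => hA.eigenvalues_nonneg _
  have hb0 : ∀ i, 0 ≤ hB.1.eigenvalues (eb i) := fun i => hB.eigenvalues_nonneg _
  have hposgen : ∀ f : Fin (n+1) → ℝ, (∀ i, 0 ≤ f i) → ∑ i, f i = 1 → ∀ α : ℝ,
      0 < ∑ i, f i ^ α := by
    intro f hf hs α
    obtain ⟨i, hi⟩ : ∃ i, f i ≠ 0 := by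
      by_contra! hcon
      simp [hcon] at hs
    exact Finset.sum_pos' (fun i _ => Real.rpow_nonneg (hf i) _)
      ⟨i, Finset.mem_univ i, Real.rpow_pos_of_pos (lt_of_le_of_ne (hf i) hi.symm) _⟩
  have hbpos : 0 < hB.1.eigenvalues (eb 0) := by
    by_contra hcon
    have : ∀ i, hB.1.eigenvalues (eb i) = 0 := fun i =>
      le_antisymm ((hvb (Fin.zero_le i)).trans (not_lt.1 hcon)) (hb0 i)
    simp [this] at hsb
  have hmul : ∀ (M : Matrix (Fin (n+1)) (Fin (n+1)) ℂ) (r : ℝ) x,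
      (inner ℂ x (((r : ℂ) • Matrix.toEuclideanLin M) x)).re =
        r * (inner ℂ x (Matrix.toEuclideanLin M x)).re := by
    intro M r x
    rw [LinearMap.smul_apply, inner_smul_right, Complex.re_ofReal_mul]
  have hBx : ∀ x, (inner ℂ x (Matrix.toEuclideanLin B x)).re =
      u * (inner ℂ x (Matrix.toEuclideanLin σ x)).re +
      (1 - u) * (inner ℂ x (Matrix.toEuclideanLin Q x)).re := by
    intro x
    rw [hBdef, map_add, map_smul, map_smul, LinearMap.add_apply, inner_add_right, Complex.add_re,
      hmul, hmul]
  obtain ⟨s0, s1, s2⟩ := spec_struct w (fun i => hA.1.eigenvalues (ea i)) (Matrix.toEuclideanLin A)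
    (((1 - u : ℝ) : ℂ) • Matrix.toEuclideanLin Q) g u ((1 - u) * lmax) hu0 hgn
    (by
      intro x
      rw [hAdef, map_add, map_smul, map_smul, LinearMap.add_apply,
        LinearMap.smul_apply (u : ℂ), hγγ, smul_smul]
      exact add_comm _ _)
    (by rw [LinearMap.smul_apply, hQg, smul_smul]; simp)
    (by
      intro x
      rw [hmul, mul_assoc]
      exact mul_le_mul_of_nonneg_left (hQq x) (by linarith))
    hw hwa
  have hab : ∀ i, i ≠ 0 → hA.1.eigenvalues (ea i) ≤ hB.1.eigenvalues (eb i) := by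
    intro j hj
    refine weyl w v (fun i => if i = 0 then (1 - u) * lmax else hA.1.eigenvalues (ea i))
      (fun i => hB.1.eigenvalues (eb i))
      (((1 - u : ℝ) : ℂ) • Matrix.toEuclideanLin Q) (Matrix.toEuclideanLin B)
      ?_ hv ?_ j _ ?_ hvb
    · intro i
      by_cases hi : i = 0
      · subst hi; rw [if_pos rfl]; exact s1
      · rw [if_neg hi]; exact (s2 i hi).1
    · intro x
      rw [hmul, hBx]
      have := mul_nonneg hu0.le (hσ0 x)
      linarith
    · intro i hij
      by_cases hi : i = 0
      · rw [if_pos hi]; exact (s2 j hj).2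
      · rw [if_neg hi]; exact hwa hij
  have h00 : hB.1.eigenvalues (eb 0) ≤ hA.1.eigenvalues (ea 0) := by
    have h1 := hBx (v 0)
    have h2 : (inner ℂ (v 0) (Matrix.toEuclideanLin B (v 0))).re = hB.1.eigenvalues (eb 0) := by
      rw [hv, inner_smul_right, inner_self_eq_norm_sq_to_K, v.norm_eq_one]; simp
    have h3 := hσ1 (v 0)
    have h4 := hQq (v 0)
    rw [v.norm_eq_one] at h3 h4
    have s0' : hA.1.eigenvalues (ea 0) = (1 - u) * lmax + u := s0
    rw [s0', ← h2, h1]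
    nlinarith
  refine ⟨?_, ?_, ?_, ?_, ?_⟩
  · exact hposgen _ (fun i => hA.eigenvalues_nonneg i) (sum_eig hA.1 hAtr) 1
  · exact hposgen _ (fun i => hA.eigenvalues_nonneg i) (sum_eig hA.1 hAtr)
  · exact hposgen _ (fun i => hB.eigenvalues_nonneg i) (sum_eig hB.1 hBtr)
  · intro α hα
    rw [← Equiv.sum_comp ea (fun i => hA.1.eigenvalues i ^ α),
      ← Equiv.sum_comp eb (fun i => hB.1.eigenvalues i ^ α)]
    exact sum_rpow_gt hα (fun i => hA.1.eigenvalues (ea i)) (fun i => hB.1.eigenvalues (eb i))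
      ha0 hvb hab h00 hbpos (hsa.trans hsb.symm)
  · intro α hα0 hα
    rw [← Equiv.sum_comp ea (fun i => hA.1.eigenvalues i ^ α),
      ← Equiv.sum_comp eb (fun i => hB.1.eigenvalues i ^ α)]
    exact sum_rpow_lt hα0 hα (fun i => hA.1.eigenvalues (ea i))
      (fun i => hB.1.eigenvalues (eb i)) ha0 hvb hab h00 hbpos (hsa.trans hsb.symm)

/-- Rényi-entropy version of the one-spin alignment minimization: among all density
matrices σ, the Rényi-α entropy S_α(u·σ + (1−u)·Q) is minimized at σ = γγ†, where γ
is a top eigenvector of Q. -/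
theorem stmt11 (α : ℝ) (hα : α ∈ Set.Ioo (0 : ℝ) 1 ∪ Set.Ioi (1 : ℝ))
    (d : ℕ) (Q : Matrix (Fin d) (Fin d) ℂ)
    (hQ : Q.PosSemidef) (hQtr : Q.trace = 1)
    (lmax : ℝ) (γ : Fin d → ℂ)
    (hγunit : ∑ i, Complex.normSq (γ i) = 1)
    (hγeig : Q *ᵥ γ = (lmax : ℂ) • γ)
    (hlmax : ∀ (v : Fin d → ℂ) (c : ℝ), v ≠ 0 → Q *ᵥ v = (c : ℂ) • v → c ≤ lmax)
    (u : ℝ) (hu : u ∈ Set.Icc (0 : ℝ) 1)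
    (σ : Matrix (Fin d) (Fin d) ℂ) (hσ : σ.PosSemidef) (hσtr : σ.trace = 1) :
    renyiEntropy α ((u : ℂ) • Matrix.vecMulVec γ (star γ) + ((1 - u : ℝ) : ℂ) • Q) ≤
      renyiEntropy α ((u : ℂ) • σ + ((1 - u : ℝ) : ℂ) • Q) := by
  rcases hu.1.eq_or_lt with h0 | hu0
  · subst h0; simp
  have hu' : (0 : ℂ) ≤ (u : ℂ) := by exact_mod_cast hu.1
  have hu'' : (0 : ℂ) ≤ ((1 - u : ℝ) : ℂ) := by
    have := sub_nonneg.2 hu.2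
    exact_mod_cast this
  have hA : ((u : ℂ) • Matrix.vecMulVec γ (star γ) + ((1 - u : ℝ) : ℂ) • Q).PosSemidef :=
    ((Matrix.posSemidef_vecMulVec_self_star γ).smul hu').add (hQ.smul hu'')
  have hB : ((u : ℂ) • σ + ((1 - u : ℝ) : ℂ) • Q).PosSemidef :=
    (hσ.smul hu').add (hQ.smul hu'')
  obtain ⟨-, pA, pB, hgt, hlt⟩ := stmt_core d Q hQ hQtr lmax γ hγunit hγeig hlmax u hu0 hu.2
    σ hσ hσtr _ _ rfl rfl hA hB
  rw [renyiEntropy, renyiEntropy, dif_pos hA.1, dif_pos hB.1]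
  rcases hα with hα | hα
  · have h1 : 0 ≤ 1 / (1 - α) := by have := hα.2; exact one_div_nonneg.2 (by linarith)
    exact mul_le_mul_of_nonneg_left
      (Real.logb_le_logb_of_le (by norm_num) (pA α) (hlt α hα.1 hα.2)) h1
  · have h1 : 1 / (1 - α) ≤ 0 := by
      have : 1 < α := hα
      exact one_div_nonpos.2 (by linarith)
    exact mul_le_mul_of_nonpos_left
      (Real.logb_le_logb_of_le (by norm_num) (pB α) (hgt α hα)) h1
end

section
/- Assume additionally μ₀ ≤ μ₁ ≤ … ≤ μ_{d−2}. For every density matrix ρ on ℂ^d there exists u ∈ [0,1] such that S(O(ρ)) − S(O^c(ρ)) ≤ S(O(ρ_u)) − S(O^c(ρ_u)), where ρ_u = (1−u)|0⟩⟨0| + u|d−1⟩⟨d−1|. (Hence the channel coherent information Q^{(1)}(O) = max_ρ [S(O(ρ)) − S(O^c(ρ))] is attained on the one-parameter family ρ_u.) -/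
open Matrix ComplexOrder

/-- The basis ket |i⟩ of ℂ^d (zero if out of range). -/
noncomputable def bket (d i : ℕ) : Fin d → ℂ := fun p => if (p : ℕ) = i then 1 else 0

/-- The projector |i⟩⟨i| on ℂ^d. -/
noncomputable def bproj (d i : ℕ) : Matrix (Fin d) (Fin d) ℂ :=
  Matrix.vecMulVec (bket d i) (star (bket d i))

/-- Kraus operator K_k = μ_k|k⟩⟨0| + |d−1⟩⟨k+1| of the channel O. -/
noncomputable def KrO (d : ℕ) (μ : ℕ → ℝ) (k : ℕ) : Matrix (Fin d) (Fin d) ℂ :=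
  ((μ k : ℝ) : ℂ) • Matrix.vecMulVec (bket d k) (star (bket d 0)) +
    Matrix.vecMulVec (bket d (d-1)) (star (bket d (k+1)))

/-- The channel O : M_d(ℂ) → M_d(ℂ) with parameters μ₀,…,μ_{d−2}. -/
noncomputable def chanO (d : ℕ) (μ : ℕ → ℝ) (X : Matrix (Fin d) (Fin d) ℂ) :
    Matrix (Fin d) (Fin d) ℂ :=
  ∑ k ∈ Finset.range (d - 1), KrO d μ k * X * (KrO d μ k)ᴴ

/-- Kraus operator L_j = μ_j|j⟩⟨0| of O^c, for 0 ≤ j ≤ d−2. -/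
noncomputable def LrO (d : ℕ) (μ : ℕ → ℝ) (j : ℕ) : Matrix (Fin (d-1)) (Fin d) ℂ :=
  ((μ j : ℝ) : ℂ) • Matrix.vecMulVec (bket (d-1) j) (star (bket d 0))

/-- Kraus operator L_{d−1} = ∑_{i=1}^{d−1}|i−1⟩⟨i| of O^c. -/
noncomputable def VrO (d : ℕ) : Matrix (Fin (d-1)) (Fin d) ℂ :=
  Matrix.of fun a b => if (b : ℕ) = (a : ℕ) + 1 then 1 else 0

/-- The complementary channel O^c : M_d(ℂ) → M_{d−1}(ℂ). -/
noncomputable def chanOc (d : ℕ) (μ : ℕ → ℝ) (X : Matrix (Fin d) (Fin d) ℂ) :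
    Matrix (Fin (d-1)) (Fin (d-1)) ℂ :=
  (∑ j ∈ Finset.range (d - 1), LrO d μ j * X * (LrO d μ j)ᴴ) + VrO d * X * (VrO d)ᴴ


lemma vn_diag {n : ℕ} (b : Fin n → ℝ) :
    vnEntropy (Matrix.diagonal (fun i => (b i : ℂ))) = -∑ i, b i * Real.logb 2 (b i) := by
  have h : (Matrix.diagonal (fun i => (b i : ℂ))).IsHermitian := by
    apply Matrix.isHermitian_diagonal_of_self_adjoint
    ext i; simp
  have h1 := h.roots_charpoly_eq_eigenvalues
  rw [Matrix.charpoly_diagonal, Polynomial.roots_prod _ _ (Finset.prod_ne_zero_iff.2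
    fun i _ => Polynomial.X_sub_C_ne_zero _)] at h1
  simp only [Polynomial.roots_X_sub_C, Multiset.bind_singleton] at h1
  have h2 : Multiset.map b Finset.univ.val = Multiset.map h.eigenvalues Finset.univ.val := by
    have := congrArg (Multiset.map Complex.re) h1
    simpa [Multiset.map_map, Function.comp_def] using this
  have h3 := congrArg (fun m => (Multiset.map (fun x : ℝ => x * Real.logb 2 x) m).sum) h2
  simp only [Multiset.map_map, Function.comp_def] at h3
  unfold vnEntropy
  rw [dif_pos h]
  exact congrArg Neg.neg h3.symm

lemma spec_conj {n : ℕ} {M : Matrix (Fin n) (Fin n) ℂ} (h : M.IsHermitian) :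
    ∃ U : Matrix (Fin n) (Fin n) ℂ, Uᴴ * U = 1 ∧ U * Uᴴ = 1 ∧
      M = U * diagonal (fun i => (h.eigenvalues i : ℂ)) * Uᴴ := by
  refine ⟨h.eigenvectorUnitary, ?_, ?_, ?_⟩
  · exact Unitary.coe_star_mul_self h.eigenvectorUnitary
  · exact Unitary.coe_mul_star_self h.eigenvectorUnitary
  · conv_lhs => rw [h.spectral_theorem, Unitary.conjStarAlgAut_apply]
    rfl

lemma vn_le_diag {n : ℕ} {M : Matrix (Fin n) (Fin n) ℂ} (hM : M.PosSemidef) :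
    vnEntropy M ≤ -∑ i, (M i i).re * Real.logb 2 (M i i).re := by
  have h := hM.1
  obtain ⟨U, hU1, hU2, hU⟩ := spec_conj h
  unfold vnEntropy
  rw [dif_pos h]
  have hd : ∀ i, (M i i).re = ∑ j, Complex.normSq (U i j) * h.eigenvalues j := by
    intro i
    have : M i i = (U * diagonal (fun i => (h.eigenvalues i : ℂ)) * Uᴴ) i i := by rw [← hU]
    rw [this, Matrix.mul_apply]
    simp only [Matrix.mul_diagonal, conjTranspose_apply, Complex.re_sum]
    refine Finset.sum_congr rfl fun j _ => ?_
    simp [Complex.normSq_apply]; ring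
  have hrow : ∀ i, ∑ j, Complex.normSq (U i j) = 1 := by
    intro i
    have := congrFun (congrFun hU2 i) i
    rw [Matrix.mul_apply] at this
    simp only [conjTranspose_apply, one_apply_eq, RCLike.star_def, Complex.mul_conj] at this
    exact_mod_cast this
  have hcol : ∀ j, ∑ i, Complex.normSq (U i j) = 1 := by
    intro i
    have := congrFun (congrFun hU1 i) i
    rw [Matrix.mul_apply] at this
    simp only [conjTranspose_apply, one_apply_eq, RCLike.star_def, ← Complex.normSq_eq_conj_mul_self] at this
    exact_mod_cast this
  have hlog : (0:ℝ) < Real.log 2 := Real.log_pos (by norm_num)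
  have key : ∀ i, (M i i).re * Real.logb 2 (M i i).re ≤
      ∑ j, Complex.normSq (U i j) * (h.eigenvalues j * Real.logb 2 (h.eigenvalues j)) := by
    intro i
    have := Real.convexOn_mul_log.map_sum_le (t := Finset.univ) (w := fun j => Complex.normSq (U i j))
      (p := h.eigenvalues) (fun j _ => Complex.normSq_nonneg _) (hrow i)
      (fun j _ => hM.eigenvalues_nonneg j)
    simp only [smul_eq_mul, ← hd] at this
    simp only [Real.logb, ← mul_div_assoc, ← Finset.sum_div]
    exact div_le_div_of_nonneg_right this hlog.le
  apply neg_le_neg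
  calc _ ≤ _ := Finset.sum_le_sum fun i _ => key i
    _ = _ := by
      rw [Finset.sum_comm]
      refine Finset.sum_congr rfl fun j _ => ?_
      rw [← Finset.sum_mul, hcol, one_mul]

lemma weyl_s12 {n : ℕ} (b : Fin n → ℝ) (hb : Monotone b) {R : Matrix (Fin n) (Fin n) ℂ}
    (hR : R.PosSemidef) (h : (diagonal (fun i => (b i : ℂ)) + R).IsHermitian)
    (s : Equiv.Perm (Fin n)) (hs : Monotone (h.eigenvalues ∘ s)) (k : Fin n) :
    b k ≤ h.eigenvalues (s k) := by
  obtain ⟨U, hU1, hU2, hU⟩ := spec_conj h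
  set l := h.eigenvalues with hl
  let F : (Fin n → ℂ) →ₗ[ℂ] ((Set.Iio k → ℂ) × (Set.Ioi k → ℂ)) :=
    LinearMap.prod ((LinearMap.funLeft ℂ ℂ (fun i : Set.Iio k => (i : Fin n))) ∘ₗ U.mulVecLin)
      (LinearMap.funLeft ℂ ℂ (fun i : Set.Ioi k => s i))
  have hF : LinearMap.ker F ≠ ⊥ := by
    apply LinearMap.ker_ne_bot_of_finrank_lt
    simp
    have := k.2
    omega
  obtain ⟨w, hw, hw0⟩ := Submodule.exists_mem_ne_zero_of_ne_bot hF
  rw [LinearMap.mem_ker] at hw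
  have hw1 : ∀ i, i < k → (U *ᵥ w) i = 0 := fun i hi => congrFun (congrArg Prod.fst hw) ⟨i, hi⟩
  have hw2 : ∀ j, k < j → w (s j) = 0 := fun i hi => congrFun (congrArg Prod.snd hw) ⟨i, hi⟩
  set x := U *ᵥ w with hx
  have hnorm : star x ⬝ᵥ x = star w ⬝ᵥ w := by
    rw [hx, star_mulVec, dotProduct_mulVec, vecMul_vecMul, hU1, vecMul_one]
  have hq : star x ⬝ᵥ ((diagonal (fun i => (b i : ℂ)) + R) *ᵥ x) =
      star w ⬝ᵥ (diagonal (fun i => (l i : ℂ)) *ᵥ w) := by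
    rw [hU, hx, star_mulVec, mulVec_mulVec, mul_assoc, hU1, mul_one, dotProduct_mulVec,
      vecMul_vecMul, ← mul_assoc, hU1, one_mul, ← dotProduct_mulVec]
  have hR0 := (Complex.nonneg_iff.1 (hR.dotProduct_mulVec_nonneg x)).1
  have dq : ∀ (c : Fin n → ℝ) (y : Fin n → ℂ), (star y ⬝ᵥ (diagonal (fun i => (c i : ℂ)) *ᵥ y)).re =
      ∑ i, c i * Complex.normSq (y i) := by
    intro c y
    simp only [dotProduct, mulVec_diagonal, Complex.re_sum, Pi.star_apply]
    refine Finset.sum_congr rfl fun i _ => ?_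
    simp [Complex.normSq_apply]; ring
  have nq : ∀ (y : Fin n → ℂ), (star y ⬝ᵥ y).re = ∑ i, Complex.normSq (y i) := by
    intro y
    simp only [dotProduct, Complex.re_sum, Pi.star_apply]
    refine Finset.sum_congr rfl fun i _ => ?_
    simp [Complex.normSq_apply]
  have hq' := congrArg Complex.re hq
  rw [add_mulVec, dotProduct_add, Complex.add_re, dq, dq] at hq'
  have hn' := congrArg Complex.re hnorm
  rw [nq, nq] at hn'
  have hpos : 0 < ∑ i, Complex.normSq (w i) := by
    obtain ⟨i, hi⟩ := Function.ne_iff.1 hw0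
    exact Finset.sum_pos' (fun _ _ => Complex.normSq_nonneg _)
      ⟨i, Finset.mem_univ _, Complex.normSq_pos.2 hi⟩
  have h1 : b k * ∑ i, Complex.normSq (x i) ≤ ∑ i, b i * Complex.normSq (x i) := by
    rw [Finset.mul_sum]
    refine Finset.sum_le_sum fun i _ => ?_
    rcases lt_or_ge i k with hi | hi
    · simp [hw1 i hi]
    · exact mul_le_mul_of_nonneg_right (hb hi) (Complex.normSq_nonneg _)
  have h2 : ∑ i, l i * Complex.normSq (w i) ≤ l (s k) * ∑ i, Complex.normSq (w i) := by
    rw [Finset.mul_sum, ← Equiv.sum_comp s, ← Equiv.sum_comp s (fun i => l (s k) * _)]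
    refine Finset.sum_le_sum fun i _ => ?_
    rcases lt_or_ge k i with hi | hi
    · simp [hw2 i hi]
    · exact mul_le_mul_of_nonneg_right (hs hi) (Complex.normSq_nonneg _)
  rw [hn'] at h1
  have : b k * ∑ i, Complex.normSq (w i) ≤ l (s k) * ∑ i, Complex.normSq (w i) := by linarith
  exact le_of_mul_le_mul_right this hpos

lemma tangent (x y : ℝ) (hx : 0 < x) (hy : 0 ≤ y) :
    x * Real.log x + (1 + Real.log x) * (y - x) ≤ y * Real.log y := by
  rcases hy.eq_or_lt with rfl | hy
  · simp; nlinarith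
  · have := Real.log_le_sub_one_of_pos (div_pos hx hy)
    rw [Real.log_div hx.ne' hy.ne'] at this
    have h2 := mul_le_mul_of_nonneg_left this hy.le
    have h3 : y * (x / y - 1) = x - y := by field_simp
    rw [h3] at h2
    nlinarith

lemma real_major {n : ℕ} (b l : Fin (n+1) → ℝ) (u : ℝ) (hu : 0 ≤ u) (hb : ∀ i, 0 ≤ b i)
    (hl : Monotone l) (hbl : ∀ i, b i ≤ l i) (hsum : ∑ i, l i = ∑ i, b i + u)
    (hpos : 0 < ∑ i, l i) :
    ∑ i, l i * Real.log (l i) ≤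
      ∑ i, (b i + if i = Fin.last n then u else 0) *
        Real.log (b i + if i = Fin.last n then u else 0) := by
  have hlast : 0 < l (Fin.last n) := by
    by_contra hc
    have : ∑ i, l i ≤ 0 := Finset.sum_nonpos fun i _ => (hl (Fin.le_last i)).trans (not_lt.1 hc)
    linarith
  set L := Real.log (l (Fin.last n)) with hL
  set c : Fin (n+1) → ℝ := fun i => b i + if i = Fin.last n then u else 0 with hc
  have hcs : ∑ i, c i = ∑ i, l i := by
    rw [hsum, hc, Finset.sum_add_distrib]; simp
  have key : ∀ i, l i * Real.log (l i) + (1 + L) * (c i - l i) ≤ c i * Real.log (c i) := by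
    intro i
    by_cases hi : i = Fin.last n
    · subst hi
      apply tangent _ _ hlast
      simp only [hc, if_true]
      linarith [hb (Fin.last n)]
    · have hci : c i = b i := by simp [hc, hi]
      rw [hci]
      have hli : 0 ≤ l i := (hb i).trans (hbl i)
      rcases hli.eq_or_lt with h0 | h0
      · have : b i = 0 := le_antisymm (h0 ▸ hbl i) (hb i)
        simp [← h0, this]
      · have h1 := tangent (l i) (b i) h0 (hb i)
        have h2 : Real.log (l i) ≤ L := Real.log_le_log h0 (hl (Fin.le_last i))
        nlinarith [hbl i]
  have := Finset.sum_le_sum fun i (_ : i ∈ Finset.univ) => key i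
  rw [Finset.sum_add_distrib, ← Finset.mul_sum, Finset.sum_sub_distrib, hcs, sub_self, mul_zero,
    add_zero] at this
  exact this

lemma vn_ge {n : ℕ} (b : Fin (n+1) → ℝ) (hb : Monotone b) (hb0 : ∀ i, 0 ≤ b i)
    {R : Matrix (Fin (n+1)) (Fin (n+1)) ℂ} (hR : R.PosSemidef) (u : ℝ) (hu : 0 ≤ u)
    (htr : R.trace = (u : ℂ)) (hpos : 0 < ∑ i, b i + u) :
    -∑ i, (b i + if i = Fin.last n then u else 0) *
        Real.logb 2 (b i + if i = Fin.last n then u else 0) ≤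
      vnEntropy (diagonal (fun i => (b i : ℂ)) + R) := by
  have h : (diagonal (fun i => (b i : ℂ)) + R).IsHermitian := by
    refine Matrix.IsHermitian.add ?_ hR.1
    apply Matrix.isHermitian_diagonal_of_self_adjoint
    ext i; simp
  unfold vnEntropy
  rw [dif_pos h]
  have hs := Tuple.monotone_sort h.eigenvalues
  set s := Tuple.sort h.eigenvalues
  have hw := weyl_s12 b hb hR h s hs
  have hsum : ∑ i, h.eigenvalues i = ∑ i, b i + u := by
    have := h.trace_eq_sum_eigenvalues
    rw [trace_add, trace_diagonal, htr] at this
    apply_fun Complex.re at this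
    simpa using this.symm
  have hsum' : ∑ i, h.eigenvalues (s i) = ∑ i, b i + u := by
    rw [Equiv.sum_comp s, hsum]
  have := real_major b (h.eigenvalues ∘ s) u hu hb0 hs hw hsum' (by
    simp only [Function.comp]; rw [hsum']; exact hpos)
  simp only [Function.comp] at this
  rw [Equiv.sum_comp s (fun i => h.eigenvalues i * Real.log (h.eigenvalues i))] at this
  apply neg_le_neg
  simp only [Real.logb, ← mul_div_assoc, ← Finset.sum_div]
  exact div_le_div_of_nonneg_right this (Real.log_pos (by norm_num)).le

lemma KrO_eq (n : ℕ) (μ : ℕ → ℝ) (k : Fin (n+1)) :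
    KrO (n+2) μ k = Matrix.single k.castSucc 0 (μ k : ℂ) + Matrix.single (Fin.last (n+1)) k.succ 1 := by
  ext i j
  simp only [KrO, bket, vecMulVec, Matrix.single, Fin.ext_iff, Matrix.add_apply, Matrix.smul_apply,
    of_apply, Pi.star_apply, RCLike.star_def, smul_eq_mul, Fin.val_castSucc, Fin.val_last, Fin.val_succ, Fin.val_zero, Nat.add_sub_cancel]
  grind

lemma LrO_eq (n : ℕ) (μ : ℕ → ℝ) (k : Fin (n+1)) :
    LrO (n+2) μ k = Matrix.single k 0 (μ k : ℂ) := by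
  ext i j
  simp only [LrO, bket, vecMulVec, Matrix.single, Fin.ext_iff, Matrix.add_apply, Matrix.smul_apply,
    of_apply, Pi.star_apply, RCLike.star_def, smul_eq_mul, Fin.val_zero]
  split_ifs <;> simp_all

lemma VrO_eq (n : ℕ) (X : Matrix (Fin (n+2)) (Fin (n+2)) ℂ) :
    VrO (n+2) * X * (VrO (n+2))ᴴ = X.submatrix Fin.succ Fin.succ := by
  have h : VrO (n+2) = (1 : Matrix (Fin (n+2)) (Fin (n+2)) ℂ).submatrix (Fin.succ : Fin (n+1) → _) id := by
    ext i j
    simp [VrO, Matrix.one_apply, Fin.ext_iff, eq_comm]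
  rw [h]
  ext i j
  simp [Matrix.mul_apply, Matrix.one_apply]

lemma chanOc_eq (n : ℕ) (μ : ℕ → ℝ) (X : Matrix (Fin (n+2)) (Fin (n+2)) ℂ) :
    chanOc (n+2) μ X = diagonal (fun i : Fin (n+1) => (μ i : ℂ)^2 * X 0 0) +
      X.submatrix Fin.succ Fin.succ := by
  unfold chanOc
  rw [VrO_eq]
  congr 1
  change ∑ j ∈ Finset.range (n+1), _ = _
  rw [Finset.sum_range]
  simp only [LrO_eq]
  ext i j
  simp [Matrix.sum_apply, conjTranspose_single, single_mul_mul_single, Matrix.single_apply, diagonal_apply]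
  by_cases hij : i = j
  · subst hij
    simp
    ring
  · have : ∀ x : Fin (n+1), ¬ (x = i ∧ x = j) := fun x hx => hij (hx.1.symm.trans hx.2)
    simp [this, hij]

lemma chanO_eq (n : ℕ) (μ : ℕ → ℝ) (X : Matrix (Fin (n+2)) (Fin (n+2)) ℂ) :
    chanO (n+2) μ X = ∑ k : Fin (n+1),
     (Matrix.single k.castSucc k.castSucc ((μ k : ℂ)^2 * X 0 0) +
      Matrix.single k.castSucc (Fin.last _) ((μ k : ℂ) * X 0 k.succ) +
      Matrix.single (Fin.last _) k.castSucc ((μ k : ℂ) * X k.succ 0) +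
      Matrix.single (Fin.last _) (Fin.last _) (X k.succ k.succ)) := by
  unfold chanO
  change ∑ j ∈ Finset.range (n+1), _ = _
  rw [Finset.sum_range]
  refine Finset.sum_congr rfl fun k _ => ?_
  rw [KrO_eq]
  simp only [conjTranspose_add, conjTranspose_single, add_mul, mul_add, single_mul_mul_single]
  simp only [RCLike.star_def, Complex.conj_ofReal, star_one, one_mul, mul_one]
  rw [show (μ k : ℂ) * X 0 0 * (μ k : ℂ) = (μ k : ℂ)^2 * X 0 0 by ring, mul_comm (X k.succ 0)]
  abel

lemma chanO_diag_cast (n : ℕ) (μ : ℕ → ℝ) (X : Matrix (Fin (n+2)) (Fin (n+2)) ℂ) (i : Fin (n+1)) :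
    chanO (n+2) μ X i.castSucc i.castSucc = (μ i : ℂ)^2 * X 0 0 := by
  rw [chanO_eq]
  simp [Matrix.sum_apply, Matrix.single_apply, Fin.castSucc_ne_last, (Fin.castSucc_ne_last _).symm]

lemma chanO_diag_last (n : ℕ) (μ : ℕ → ℝ) (X : Matrix (Fin (n+2)) (Fin (n+2)) ℂ) :
    chanO (n+2) μ X (Fin.last _) (Fin.last _) = ∑ k : Fin (n+1), X k.succ k.succ := by
  rw [chanO_eq]
  simp [Matrix.sum_apply, Matrix.single_apply, Fin.castSucc_ne_last, (Fin.castSucc_ne_last _).symm]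

lemma chanO_psd (n : ℕ) (μ : ℕ → ℝ) {X : Matrix (Fin (n+2)) (Fin (n+2)) ℂ} (hX : X.PosSemidef) :
    (chanO (n+2) μ X).PosSemidef := by
  unfold chanO
  exact Matrix.posSemidef_sum _ fun k _ => hX.mul_mul_conjTranspose_same _

lemma chanO_off (n : ℕ) (μ : ℕ → ℝ) {X : Matrix (Fin (n+2)) (Fin (n+2)) ℂ}
    (h1 : ∀ k : Fin (n+1), X 0 k.succ = 0) (h2 : ∀ k : Fin (n+1), X k.succ 0 = 0) :
    chanO (n+2) μ X = diagonal (fun i => chanO (n+2) μ X i i) := by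
  ext i j
  by_cases hij : i = j
  · subst hij; simp
  · rw [diagonal_apply_ne _ hij, chanO_eq]
    have h3 : ∀ x : Fin (n+1), ¬ (x.castSucc = i ∧ x.castSucc = j) :=
      fun x hx => hij (hx.1.symm.trans hx.2)
    have h4 : ¬ (Fin.last (n+1) = i ∧ Fin.last (n+1) = j) :=
      fun hx => hij (hx.1.symm.trans hx.2)
    simp [Matrix.sum_apply, Matrix.single_apply, h1, h2, h3, h4]

lemma rhou (n : ℕ) (u : ℝ) :
    (((1 - u : ℝ) : ℂ) • bproj (n+2) 0 + (u : ℂ) • bproj (n+2) (n+2-1)) =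
      diagonal (fun i => ((if i = 0 then 1 - u else if i = Fin.last _ then u else 0 : ℝ) : ℂ)) := by
  ext i j
  simp only [bproj, bket, vecMulVec, Matrix.add_apply, Matrix.smul_apply, of_apply, diagonal_apply,
    Pi.star_apply, RCLike.star_def, smul_eq_mul, Fin.ext_iff, Fin.val_zero, Fin.val_last]
  have : n + 2 - 1 = n + 1 := rfl
  rw [this]
  by_cases hij : (i:ℕ) = j
  · rw [← hij]
    by_cases h0 : (i:ℕ) = 0
    · simp [h0]
    · by_cases h1 : (i:ℕ) = n + 1
      · simp [h1]
      · simp [h0, h1]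
  · simp only [hij, if_false]
    by_cases h0 : (i:ℕ) = 0
    · have : ¬ (j:ℕ) = 0 := fun h => hij (h0.trans h.symm)
      simp [h0, this]
    · by_cases h1 : (i:ℕ) = n + 1
      · have : ¬ (j:ℕ) = n + 1 := fun h => hij (h1.trans h.symm)
        simp [h0, this]
      · simp [h0, h1]

/-- The coherent information of O is attained on the one-parameter family
ρ_u = (1−u)|0⟩⟨0| + u|d−1⟩⟨d−1|. -/
theorem stmt12 (d : ℕ) (hd : 3 ≤ d) (μ : ℕ → ℝ)
    (hμ0 : ∀ j < d - 1, 0 ≤ μ j)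
    (hμsum : ∑ j ∈ Finset.range (d - 1), (μ j) ^ 2 = 1)
    (hμmono : ∀ j k, j ≤ k → k < d - 1 → μ j ≤ μ k)
    (ρ : Matrix (Fin d) (Fin d) ℂ) (hρ : ρ.PosSemidef) (hρtr : ρ.trace = 1) :
    ∃ u ∈ Set.Icc (0 : ℝ) 1,
      vnEntropy (chanO d μ ρ) - vnEntropy (chanOc d μ ρ) ≤
        vnEntropy (chanO d μ (((1 - u : ℝ) : ℂ) • bproj d 0 + (u : ℂ) • bproj d (d-1))) -
        vnEntropy (chanOc d μ (((1 - u : ℝ) : ℂ) • bproj d 0 + (u : ℂ) • bproj d (d-1))) := by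
  obtain ⟨n, rfl⟩ : ∃ n, d = n + 2 := ⟨d - 2, by omega⟩
  replace hμsum : ∑ j ∈ Finset.range (n + 1), (μ j) ^ 2 = 1 := hμsum
  rw [Finset.sum_range] at hμsum
  have hsub : (ρ.submatrix (Fin.succ : Fin (n+1) → _) Fin.succ).PosSemidef := hρ.submatrix _
  have hnn : ∀ i, 0 ≤ ρ i i := fun i => hρ.diag_nonneg
  set a : ℝ := (ρ 0 0).re with ha
  have ha0 : 0 ≤ a := (Complex.nonneg_iff.1 (hnn 0)).1
  have haC : ρ 0 0 = (a : ℂ) := Complex.ext rfl (by simpa using (Complex.nonneg_iff.1 (hnn 0)).2.symm)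
  have htr : ∑ k : Fin (n+1), ρ k.succ k.succ = ((1 - a : ℝ) : ℂ) := by
    have h := hρtr
    rw [Matrix.trace, Fin.sum_univ_succ] at h
    simp only [diag_apply] at h
    rw [haC] at h
    push_cast
    exact eq_sub_of_add_eq' h
  have hu0 : 0 ≤ 1 - a := by
    have : (0:ℂ) ≤ ((1 - a : ℝ) : ℂ) := htr ▸ Finset.sum_nonneg fun i _ => hnn _
    exact_mod_cast this
  refine ⟨1 - a, ⟨hu0, by linarith⟩, ?_⟩
  rw [rhou]
  set D : Matrix (Fin (n+2)) (Fin (n+2)) ℂ := diagonal (fun i => ((if i = 0 then 1 - (1 - a)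
    else if i = Fin.last _ then 1 - a else 0 : ℝ) : ℂ)) with hD
  have hD00 : D 0 0 = (a : ℂ) := by simp [hD]
  have hDs : ∀ k : Fin (n+1), D k.succ k.succ = ((if k = Fin.last _ then 1 - a else 0 : ℝ) : ℂ) := by
    intro k
    rw [hD, diagonal_apply_eq, if_neg (Fin.succ_ne_zero k), ← Fin.succ_last]
    simp only [Fin.succ_inj]
  have hdiag : ∀ i, ((chanO (n+2) μ ρ i i).re : ℂ) = chanO (n+2) μ D i i := by
    intro i
    induction i using Fin.lastCases with
    | last =>
      rw [chanO_diag_last, chanO_diag_last, htr, Complex.ofReal_re]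
      simp only [hDs]
      rw [← Complex.ofReal_sum]
      simp
    | cast i =>
      rw [chanO_diag_cast, chanO_diag_cast, haC, hD00, ← Complex.ofReal_pow, ← Complex.ofReal_mul,
        Complex.ofReal_re]
  have hO : vnEntropy (chanO (n+2) μ ρ) ≤ vnEntropy (chanO (n+2) μ D) := by
    rw [chanO_off n μ (X := D) (fun k => by simp [hD, (Fin.succ_ne_zero k).symm])
      (fun k => by simp [hD, Fin.succ_ne_zero k])]
    simp only [← hdiag]
    rw [vn_diag]
    exact vn_le_diag (chanO_psd n μ hρ)
  have hOc : vnEntropy (chanOc (n+2) μ D) ≤ vnEntropy (chanOc (n+2) μ ρ) := by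
    have e1 : chanOc (n+2) μ D = diagonal (fun i : Fin (n+1) =>
        ((μ i ^ 2 * a + if i = Fin.last n then 1 - a else 0 : ℝ) : ℂ)) := by
      rw [chanOc_eq]
      ext i j
      by_cases hij : i = j
      · subst hij
        rw [Matrix.add_apply, diagonal_apply_eq, diagonal_apply_eq, submatrix_apply, hDs, hD00]
        push_cast
        rfl
      · rw [Matrix.add_apply, diagonal_apply_ne _ hij, diagonal_apply_ne _ hij, submatrix_apply, hD,
          diagonal_apply_ne _ (by simpa using hij), add_zero]
    have e2 : chanOc (n+2) μ ρ = diagonal (fun i : Fin (n+1) => ((μ i ^ 2 * a : ℝ) : ℂ)) +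
        ρ.submatrix Fin.succ Fin.succ := by
      rw [chanOc_eq, haC]
      push_cast
      rfl
    rw [e1, e2]
    refine (vn_diag (n := n + 1) _).trans_le ?_
    refine vn_ge (n := n) (fun i => μ i ^ 2 * a) ?_ ?_ hsub (1 - a) hu0 htr ?_
    · intro i j hij
      have h1 := hμ0 i i.2
      have h2 := hμmono i j hij j.2
      exact mul_le_mul_of_nonneg_right (pow_le_pow_left₀ h1 h2 2) ha0
    · intro i; positivity
    · rw [← Finset.sum_mul, hμsum]; linarith
  exact sub_le_sub hO hOc
end
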